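/- Let R be a commutative noetherian ring, C a semidualizing R-module, M an R-module, and n ≥ 0. Then M admits a C-flat resolution of length at most n (an exact sequence 0 → X_n → ⋯ → X_0 → M → 0 with each X_i C-flat) if and only if the Pontryagin dual M* = Hom_ℤ(M, ℚ/ℤ) admits a C-injective coresolution of length at most n (an exact sequence 0 → M* → Y_0 → ⋯ → Y_n → 0 with each Y_i C-injective). Consequently the C-flat projective dimension of M equals the C-injective injective dimension of M*. -/

import Mathlib

open CategoryTheory TensorProduct

universe u

section
variable (R : Type u) [CommRing R]

def extZero (M N : ModuleCat.{u} R) : Prop :=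
  ∀ i : ℕ, 1 ≤ i → Subsingleton (((Ext R (ModuleCat.{u} R) i).obj (Opposite.op M)).obj N)

def torZero (M N : ModuleCat.{u} R) : Prop :=
  ∀ i : ℕ, 1 ≤ i → Subsingleton (((Tor (ModuleCat.{u} R) i).obj M).obj N)

def IsSemidualizing (C : ModuleCat.{u} R) : Prop :=
  Module.Finite R C ∧ Function.Bijective (LinearMap.lsmul R C) ∧ extZero R C C

/-- A module is `C`-flat if it is isomorphic to `F ⊗[R] C` with `F` flat. -/
def IsCFlat (C M : ModuleCat.{u} R) : Prop :=
  ∃ F : ModuleCat.{u} R, Module.Flat R F ∧ Nonempty (M ≃ₗ[R] (F ⊗[R] C))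

def IsCInjective (C M : ModuleCat.{u} R) : Prop :=
  ∃ I : ModuleCat.{u} R, Module.Injective R I ∧ Nonempty (M ≃ₗ[R] (↥C →ₗ[R] ↥I))

/-- cotorsion: `Ext^{≥1}(F, N) = 0` for all flat `F`. -/
def IsCotorsion (N : ModuleCat.{u} R) : Prop :=
  ∀ F : ModuleCat.{u} R, Module.Flat R F → extZero R F N

/-- `C`-cotorsion: `Ext^{≥1}(F ⊗ C, N) = 0` for all flat `F`. -/
def IsCCotorsion (C N : ModuleCat.{u} R) : Prop :=
  ∀ F : ModuleCat.{u} R, Module.Flat R F →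
    extZero R (ModuleCat.of R (↥F ⊗[R] ↥C)) N

/-- `C`-flat `C`-cotorsion: isomorphic to `F ⊗ C` with `F` flat and cotorsion. -/
def IsCFlatCotorsion (C M : ModuleCat.{u} R) : Prop :=
  ∃ F : ModuleCat.{u} R, Module.Flat R F ∧ IsCotorsion R F ∧
    Nonempty (M ≃ₗ[R] (F ⊗[R] C))

/-- The natural evaluation map `C ⊗ Hom(C,M) → M`. -/
noncomputable def evalMap (C M : ModuleCat.{u} R) :
    (↥C ⊗[R] (↥C →ₗ[R] ↥M)) →ₗ[R] ↥M :=
  TensorProduct.lift (LinearMap.id (R := R) (M := ↥C →ₗ[R] ↥M)).flip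

/-- The Bass class `B_C(R)`. -/
noncomputable def InBassClass (C M : ModuleCat.{u} R) : Prop :=
  extZero R C M ∧
  torZero R C (ModuleCat.of R (↥C →ₗ[R] ↥M)) ∧
  Function.Bijective (evalMap R C M)

/-- A `ℤ`-indexed complex of `R`-modules: `d i : X (i+1) → X i`. -/
structure ZComplex where
  X : ℤ → ModuleCat.{u} R
  d : ∀ i : ℤ, ↥(X (i + 1)) →ₗ[R] ↥(X i)
  d_comp_d : ∀ i : ℤ, (d i).comp (d (i + 1)) = 0

namespace ZComplex

variable {R} (Z : ZComplex R)

/-- Exactness of the complex. -/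
def IsExact : Prop := ∀ i : ℤ, Function.Exact (Z.d (i + 1)) (Z.d i)

/-- Exactness of `Z ⊗[R] J`. -/
def TensorExact (J : ModuleCat.{u} R) : Prop :=
  ∀ i : ℤ, Function.Exact (LinearMap.rTensor (↥J) (Z.d (i + 1)))
    (LinearMap.rTensor (↥J) (Z.d i))

/-- Exactness of `Hom_R(V, Z)`. -/
def HomFromExact (V : ModuleCat.{u} R) : Prop :=
  ∀ i : ℤ, Function.Exact
    (fun f : ↥V →ₗ[R] ↥(Z.X (i + 1 + 1)) => (Z.d (i + 1)).comp f)
    (fun f : ↥V →ₗ[R] ↥(Z.X (i + 1)) => (Z.d i).comp f)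

/-- Exactness of `Hom_R(Z, V)`. -/
def HomToExact (V : ModuleCat.{u} R) : Prop :=
  ∀ i : ℤ, Function.Exact
    (fun g : ↥(Z.X i) →ₗ[R] ↥V => g.comp (Z.d i))
    (fun g : ↥(Z.X (i + 1)) →ₗ[R] ↥V => g.comp (Z.d (i + 1)))

/-- `M ≅ Coker(∂₁)`. -/
def IsCokerOfD1 (M : ModuleCat.{u} R) : Prop :=
  Nonempty (↥M ≃ₗ[R] (↥(Z.X 0) ⧸ LinearMap.range (Z.d 0)))

end ZComplex

end

section
variable (R : Type u) [CommRing R]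

/-- A complete `FF_C`-resolution witnessing that `M` is `G_C`-flat. -/
def IsGCFlat (C M : ModuleCat.{u} R) : Prop :=
  ∃ Z : ZComplex R, Z.IsExact ∧
    (∀ i : ℤ, 0 ≤ i → Module.Flat R (Z.X i)) ∧
    (∀ i : ℤ, i < 0 → IsCFlat R C (Z.X i)) ∧
    (∀ J : ModuleCat.{u} R, IsCInjective R C J → Z.TensorExact J) ∧
    Z.IsCokerOfD1 M

def IsCProjective (C M : ModuleCat.{u} R) : Prop :=
  ∃ P : ModuleCat.{u} R, Module.Projective R P ∧ Nonempty (M ≃ₗ[R] (P ⊗[R] C))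

/-- A complete `PP_C`-resolution witnessing that `M` is `G_C`-projective. -/
def IsGCProjective (C M : ModuleCat.{u} R) : Prop :=
  ∃ Z : ZComplex R, Z.IsExact ∧
    (∀ i : ℤ, 0 ≤ i → Module.Projective R (Z.X i)) ∧
    (∀ i : ℤ, i < 0 → IsCProjective R C (Z.X i)) ∧
    (∀ Q : ModuleCat.{u} R, IsCProjective R C Q → Z.HomToExact Q) ∧
    Z.IsCokerOfD1 M

/-- `G(𝒳)` for a class `𝒳` of modules. -/
def GClass (𝒳 : ModuleCat.{u} R → Prop) (M : ModuleCat.{u} R) : Prop :=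
  ∃ Z : ZComplex R, Z.IsExact ∧
    (∀ i : ℤ, 𝒳 (Z.X i)) ∧
    (∀ V : ModuleCat.{u} R, 𝒳 V → Z.HomFromExact V) ∧
    (∀ V : ModuleCat.{u} R, 𝒳 V → Z.HomToExact V) ∧
    Z.IsCokerOfD1 M

/-- Iterates `G^n(𝒳)`, with `G^0(𝒳) = 𝒳`. -/
def GIter : ℕ → (ModuleCat.{u} R → Prop) → (ModuleCat.{u} R → Prop)
  | 0, 𝒳 => 𝒳
  | n + 1, 𝒳 => GClass R (GIter n 𝒳)

/-- `H_C(𝒳)`: modules with a `P_C F_C^cot`-complete `𝒳`-resolution. -/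
def HClass (C : ModuleCat.{u} R) (𝒳 : ModuleCat.{u} R → Prop) (M : ModuleCat.{u} R) : Prop :=
  ∃ Z : ZComplex R, Z.IsExact ∧
    (∀ i : ℤ, 𝒳 (Z.X i)) ∧
    (∀ P : ModuleCat.{u} R, Module.Projective R P →
      Z.HomFromExact (ModuleCat.of R (↥P ⊗[R] ↥C))) ∧
    (∀ N : ModuleCat.{u} R, IsCFlatCotorsion R C N → Z.HomToExact N) ∧
    Z.IsCokerOfD1 M

/-- Iterates `H_C^n(𝒳)`, with `H_C^0(𝒳) = 𝒳`. -/
def HIter (C : ModuleCat.{u} R) : ℕ → (ModuleCat.{u} R → Prop) → (ModuleCat.{u} R → Prop)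
  | 0, 𝒳 => 𝒳
  | n + 1, 𝒳 => HClass R C (HIter C n 𝒳)

/-- `M` admits a resolution `0 → X_n → ⋯ → X_0 → M → 0` with each `X_i` in `𝒳`. -/
def HasResOfLength (𝒳 : ModuleCat.{u} R → Prop) (n : ℕ) (M : ModuleCat.{u} R) : Prop :=
  ∃ (P : ℕ → ModuleCat.{u} R) (d : ∀ i : ℕ, ↥(P (i + 1)) →ₗ[R] ↥(P i))
    (ε : ↥(P 0) →ₗ[R] ↥M),
      Function.Surjective ε ∧ Function.Exact (d 0) ε ∧
      (∀ i : ℕ, Function.Exact (d (i + 1)) (d i)) ∧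
      (∀ i : ℕ, i ≤ n → 𝒳 (P i)) ∧
      (∀ i : ℕ, n < i → Subsingleton (P i))

/-- `M` admits a coresolution `0 → M → Y_0 → ⋯ → Y_n → 0` with each `Y_i` in `𝒳`. -/
def HasCoresOfLength (𝒳 : ModuleCat.{u} R → Prop) (n : ℕ) (M : ModuleCat.{u} R) : Prop :=
  ∃ (P : ℕ → ModuleCat.{u} R) (d : ∀ i : ℕ, ↥(P i) →ₗ[R] ↥(P (i + 1)))
    (η : ↥M →ₗ[R] ↥(P 0)),
      Function.Injective η ∧ Function.Exact η (d 0) ∧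
      (∀ i : ℕ, Function.Exact (d i) (d (i + 1))) ∧
      (∀ i : ℕ, i ≤ n → 𝒳 (P i)) ∧
      (∀ i : ℕ, n < i → Subsingleton (P i))

/-- `C` is a dualizing module: semidualizing of finite injective dimension. -/
def IsDualizing (C : ModuleCat.{u} R) : Prop :=
  IsSemidualizing R C ∧
  ∃ n : ℕ, HasCoresOfLength R (fun I => Module.Injective R ↥I) n C

end

section ExtComparison
variable {R : Type u} [CommRing R]

lemma subsingleton_abelianExt_of_extZero {M N : ModuleCat.{u} R} (h : extZero R M N) (i : ℕ) :
    Subsingleton (Abelian.Ext M N (i + 1)) := by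
  let P : ProjectiveResolution M := Classical.choice (HasProjectiveResolution.out)
  have hsub := h (i + 1) (by omega)
  have hz : Limits.IsZero ((P.complex.linearYonedaObj R N).homology (i + 1)) :=
    (ModuleCat.isZero_of_subsingleton _).of_iso (P.isoExt (R := R) (i + 1) N).symm
  rw [← HomologicalComplex.exactAt_iff_isZero_homology,
    HomologicalComplex.exactAt_iff' _ i (i + 1) (i + 1 + 1) (by simp) (by simp),
    ShortComplex.moduleCat_exact_iff] at hz
  refine subsingleton_of_forall_eq 0 fun α => ?_
  obtain ⟨f, hf, rfl⟩ := P.extMk_surjective α (i + 1 + 1) rfl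
  rw [P.extMk_eq_zero_iff f _ rfl hf i rfl]
  exact hz f hf

/-- The syzygies of `C`: the smallest class of modules containing `C` and closed under kernels of
surjections from finite free modules. -/
inductive IsSyzygy (C : ModuleCat.{u} R) : ModuleCat.{u} R → Prop
  | self : IsSyzygy C C
  | ker {A : ModuleCat.{u} R} (hA : IsSyzygy C A) {m : ℕ} (π : (Fin m → R) →ₗ[R] A)
      (hπ : Function.Surjective π) : IsSyzygy C (ModuleCat.of R (LinearMap.ker π))

lemma shortExact_of_exact {N Y Z : Type u} [AddCommGroup N] [Module R N] [AddCommGroup Y]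
    [Module R Y] [AddCommGroup Z] [Module R Z] {i : N →ₗ[R] Y} {q : Y →ₗ[R] Z}
    (hi : Function.Injective i) (hq : Function.Surjective q)
    (hiq : Function.Exact i q) :
    (ShortComplex.mk (ModuleCat.ofHom i) (ModuleCat.ofHom q)
      (ModuleCat.hom_ext hiq.linearMap_comp_eq_zero)).ShortExact where
  exact := by
    rw [ShortComplex.moduleCat_exact_iff]
    exact fun x hx => (hiq x).1 hx
  mono_f := (ModuleCat.mono_iff_injective _).2 hi
  epi_g := (ModuleCat.epi_iff_surjective _).2 hq

lemma shortExact_ker {Y Z : Type u} [AddCommGroup Y] [Module R Y] [AddCommGroup Z] [Module R Z]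
    (q : Y →ₗ[R] Z) (hq : Function.Surjective q) :
    (ShortComplex.mk (ModuleCat.ofHom (LinearMap.ker q).subtype) (ModuleCat.ofHom q)
      (ModuleCat.hom_ext (LinearMap.exact_subtype_ker_map q).linearMap_comp_eq_zero)).ShortExact :=
  shortExact_of_exact (Submodule.subtype_injective _) hq (LinearMap.exact_subtype_ker_map q)

lemma IsSyzygy.subsingleton_ext {C N A : ModuleCat.{u} R} (h : extZero R C N)
    (hA : IsSyzygy C A) (i : ℕ) : Subsingleton (Abelian.Ext A N (i + 1)) := by
  induction hA generalizing i with
  | self => exact subsingleton_abelianExt_of_extZero h i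
  | @ker A hA m π hπ ih =>
    refine subsingleton_of_forall_eq 0 fun x => ?_
    have := ih (i + 1)
    have hp : Projective (ModuleCat.of R (Fin m → R)) :=
      (IsProjective.iff_projective _).1 inferInstance
    obtain ⟨y, rfl⟩ := Abelian.Ext.contravariant_sequence_exact₁ (shortExact_ker π hπ) N x
      (n₁ := i + 1 + 1) (by omega) (Subsingleton.elim _ _)
    rw [Abelian.Ext.eq_zero_of_projective (P := ModuleCat.of R (Fin m → R)) y]
    exact Abelian.Ext.comp_zero _ _ _ _ _

/-- The vanishing of `Ext^i(C, N)` for `i ≥ 1`, expressed through the syzygies of `C`. -/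
def SyzygyMapsExtend (C : ModuleCat.{u} R) (N : Type u) [AddCommGroup N] [Module R N] : Prop :=
  ∀ A : ModuleCat.{u} R, IsSyzygy C A → ∀ (m : ℕ) (π : (Fin m → R) →ₗ[R] A),
    Function.Surjective π → Function.Surjective (LinearMap.lcomp R N (LinearMap.ker π).subtype)

lemma syzygyMapsExtend_of_extZero {C N : ModuleCat.{u} R} (h : extZero R C N) :
    SyzygyMapsExtend C N := by
  intro A hA m π hπ f
  have := hA.subsingleton_ext h 0
  obtain ⟨y, hy⟩ := Abelian.Ext.contravariant_sequence_exact₁ (shortExact_ker π hπ) N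
    (Abelian.Ext.mk₀ (ModuleCat.ofHom f)) (n₁ := 1) (by omega) (Subsingleton.elim _ _)
  obtain ⟨g, rfl⟩ := (Abelian.Ext.mk₀_bijective _ _).2 y
  rw [Abelian.Ext.mk₀_comp_mk₀] at hy
  exact ⟨g.hom, congrArg ModuleCat.Hom.hom ((Abelian.Ext.mk₀_bijective _ _).1 hy)⟩

lemma IsSyzygy.finite [IsNoetherianRing R] {C A : ModuleCat.{u} R} (hC : Module.Finite R C)
    (hA : IsSyzygy C A) : Module.Finite R A := by
  cases hA with
  | self => exact hC
  | ker hA π hπ => exact inferInstanceAs (Module.Finite R (LinearMap.ker π))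

end ExtComparison

section TensorEvaluation
variable {R : Type u} [CommRing R]

lemma Module.Injective.exists_comp_eq {X Y E : Type u} [AddCommGroup X] [Module R X]
    [AddCommGroup Y] [Module R Y] [AddCommGroup E] [Module R E] (hE : Module.Injective R E)
    {f : X →ₗ[R] Y} (hf : Function.Injective f) (φ : X →ₗ[R] E) :
    ∃ ψ : Y →ₗ[R] E, ψ ∘ₗ f = φ := by
  obtain ⟨ψ, hψ⟩ := hE.out f hf φ
  exact ⟨ψ, LinearMap.ext hψ⟩

lemma Module.Injective.exists_comp_eq_of_ker_le {Y Z E : Type u} [AddCommGroup Y] [Module R Y]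
    [AddCommGroup Z] [Module R Z] [AddCommGroup E] [Module R E] (hE : Module.Injective R E)
    (g : Y →ₗ[R] Z) (φ : Y →ₗ[R] E) (h : LinearMap.ker g ≤ LinearMap.ker φ) :
    ∃ χ : Z →ₗ[R] E, χ ∘ₗ g = φ := by
  obtain ⟨χ, hχ⟩ := hE.exists_comp_eq (f := (LinearMap.ker g).liftQ g le_rfl)
    (LinearMap.ker_eq_bot.1 (Submodule.ker_liftQ_eq_bot _ _ _ le_rfl))
    ((LinearMap.ker g).liftQ φ h)
  exact ⟨χ, LinearMap.ext fun y => LinearMap.congr_fun hχ (Submodule.Quotient.mk y)⟩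

section
variable (A A' M E : Type*) [AddCommGroup A] [Module R A] [AddCommGroup A'] [Module R A']
  [AddCommGroup M] [Module R M] [AddCommGroup E] [Module R E]

/-- The tensor evaluation map `a ⊗ f ↦ (g ↦ f (g a))`. -/
noncomputable def tensorEval : A ⊗[R] (M →ₗ[R] E) →ₗ[R] (A →ₗ[R] M) →ₗ[R] E :=
  TensorProduct.lift (LinearMap.mk₂ R (fun a f => f ∘ₗ LinearMap.applyₗ a)
    (fun _ _ _ => by ext; simp) (fun _ _ _ => by ext; simp)
    (fun _ _ _ => by ext; simp) (fun _ _ _ => by ext; simp))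

variable {A A' M E}

@[simp]
lemma tensorEval_tmul (a : A) (f : M →ₗ[R] E) (g : A →ₗ[R] M) :
    tensorEval A M E (a ⊗ₜ f) g = f (g a) := rfl

lemma tensorEval_rTensor (p : A →ₗ[R] A') (t : A ⊗[R] (M →ₗ[R] E)) :
    tensorEval A' M E (p.rTensor _ t) = tensorEval A M E t ∘ₗ p.lcomp R M := by
  induction t with
  | zero => simp
  | tmul a f => ext; simp
  | add x y hx hy => simp [hx, hy, LinearMap.add_comp]

variable (M E) in
lemma tensorEval_bijective_pi (m : ℕ) :
    Function.Bijective (tensorEval (R := R) (Fin m → R) M E) := by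
  let σ (i : Fin m) : M →ₗ[R] (Fin m → R) →ₗ[R] M := LinearMap.smulRightₗ (LinearMap.proj i)
  have left_inv (t : (Fin m → R) ⊗[R] (M →ₗ[R] E)) :
      ∑ i, Pi.single i (1 : R) ⊗ₜ[R] (tensorEval _ M E t ∘ₗ σ i) = t := by
    induction t with
    | zero => simp
    | tmul a f =>
      have h (i : Fin m) : tensorEval _ M E (a ⊗ₜ[R] f) ∘ₗ σ i = a i • f := by
        ext x
        simp [σ]
      simp_rw [h, TensorProduct.tmul_smul, TensorProduct.smul_tmul', ← TensorProduct.sum_tmul]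
      congr 1
      exact (pi_eq_sum_univ' a).symm
    | add x y hx hy =>
      simp_rw [map_add, LinearMap.add_comp, TensorProduct.tmul_add, Finset.sum_add_distrib, hx, hy]
  refine ⟨fun t t' h => by rw [← left_inv t, h, left_inv], fun φ =>
    ⟨∑ i, Pi.single i (1 : R) ⊗ₜ[R] (φ ∘ₗ σ i), ?_⟩⟩
  ext g
  simp only [map_sum, LinearMap.sum_apply, tensorEval_tmul, LinearMap.comp_apply]
  rw [← map_sum]
  congr 1
  ext i
  simp [σ, Pi.single_apply]

end

lemma tensorEval_surjective {A M E : Type u} [AddCommGroup A] [Module R A] [AddCommGroup M]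
    [Module R M] [AddCommGroup E] [Module R E] [Module.Finite R A] (hE : Module.Injective R E) :
    Function.Surjective (tensorEval (R := R) A M E) := by
  intro φ
  obtain ⟨m, π, hπ⟩ := Module.Finite.exists_fin' R A
  obtain ⟨ψ, hψ⟩ := hE.exists_comp_eq (f := π.lcomp R M)
    (fun f g h => LinearMap.ext fun a => by
      obtain ⟨x, rfl⟩ := hπ a
      exact LinearMap.congr_fun h x) φ
  obtain ⟨t, rfl⟩ := (tensorEval_bijective_pi M E m).2 ψ
  exact ⟨π.rTensor _ t, by rw [tensorEval_rTensor, hψ]⟩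

lemma tensorEval_bijective [IsNoetherianRing R] {A M E : Type u} [AddCommGroup A] [Module R A]
    [AddCommGroup M] [Module R M] [AddCommGroup E] [Module R E] [Module.Finite R A]
    (hE : Module.Injective R E) : Function.Bijective (tensorEval (R := R) A M E) := by
  refine ⟨(injective_iff_map_eq_zero _).2 fun t ht => ?_, tensorEval_surjective hE⟩
  obtain ⟨m, π, hπ⟩ := Module.Finite.exists_fin' R A
  obtain ⟨s, rfl⟩ := LinearMap.rTensor_surjective (M →ₗ[R] E) hπ t
  rw [tensorEval_rTensor] at ht
  obtain ⟨χ, hχ⟩ := hE.exists_comp_eq_of_ker_le ((LinearMap.ker π).subtype.lcomp R M)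
    (tensorEval _ M E s) (fun g hg => by
      obtain ⟨g', rfl⟩ : ∃ g' : A →ₗ[R] M, g' ∘ₗ π = g := by
        refine ⟨(LinearMap.ker π).liftQ g (fun x hx => LinearMap.congr_fun hg ⟨x, hx⟩) ∘ₗ
          (π.quotKerEquivOfSurjective hπ).symm, LinearMap.ext fun x => ?_⟩
        have : (π.quotKerEquivOfSurjective hπ).symm (π x) = Submodule.Quotient.mk x := by
          rw [LinearEquiv.symm_apply_eq]; rfl
        simp only [LinearMap.comp_apply, LinearEquiv.coe_coe, this]
        rfl
      exact LinearMap.congr_fun ht g')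
  obtain ⟨r, rfl⟩ := tensorEval_surjective hE χ
  rw [← tensorEval_rTensor] at hχ
  rw [← (tensorEval_bijective_pi M E m).1 hχ, ← LinearMap.rTensor_comp_apply,
    show π ∘ₗ (LinearMap.ker π).subtype = 0 by ext x; exact x.2, LinearMap.rTensor_zero,
    LinearMap.zero_apply]

end TensorEvaluation

section AuslanderClass
variable {R : Type u} [CommRing R] (C : ModuleCat.{u} R)

/-- The vanishing of `Tor_i(C, N)` for `i ≥ 1`, expressed through the syzygies of `C`. -/
def SyzygyTensorInjective (N : Type u) [AddCommGroup N] [Module R N] : Prop :=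
  ∀ A : ModuleCat.{u} R, IsSyzygy C A → ∀ (m : ℕ) (π : (Fin m → R) →ₗ[R] A),
    Function.Surjective π → Function.Injective ((LinearMap.ker π).subtype.rTensor N)

/-- The unit `N → Hom(C, C ⊗ N)` of the tensor-hom adjunction. -/
noncomputable def tensorUnit (N : Type u) [AddCommGroup N] [Module R N] :
    N →ₗ[R] C →ₗ[R] C ⊗[R] N :=
  (TensorProduct.mk R C N).flip

variable {C} {N Y Z : Type u} [AddCommGroup N] [Module R N] [AddCommGroup Y] [Module R Y]
  [AddCommGroup Z] [Module R Z]

@[simp]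
lemma tensorUnit_apply (x : N) (c : C) : tensorUnit C N x c = c ⊗ₜ x := rfl

lemma lTensor_comp_tensorUnit (f : N →ₗ[R] Y) (x : N) :
    f.lTensor C ∘ₗ tensorUnit C N x = tensorUnit C Y (f x) := by
  ext; simp

lemma syzygyTensorInjective_iff :
    SyzygyTensorInjective C N ↔ SyzygyMapsExtend C (CharacterModule N) := by
  simp only [SyzygyTensorInjective, SyzygyMapsExtend, rTensor_injective_iff_lcomp_surjective]

lemma SyzygyTensorInjective.of_flat [Module.Flat R N] : SyzygyTensorInjective C N :=
  fun _ _ _ _ _ => Module.Flat.rTensor_preserves_injective_linearMap _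
    (Submodule.subtype_injective _)

lemma SyzygyMapsExtend.of_injective (hN : Module.Injective R N) : SyzygyMapsExtend C N :=
  fun _ _ _ _ _ f => hN.exists_comp_eq (Submodule.subtype_injective _) f

lemma SyzygyMapsExtend.of_linearEquiv (e : N ≃ₗ[R] Y) (h : SyzygyMapsExtend C N) :
    SyzygyMapsExtend C Y := by
  intro A hA m π hπ f
  obtain ⟨g, hg⟩ := h A hA m π hπ (e.symm.toLinearMap ∘ₗ f)
  refine ⟨e.toLinearMap ∘ₗ g, LinearMap.ext fun x => ?_⟩
  have := LinearMap.congr_fun hg x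
  simp only [LinearMap.lcomp_apply, LinearMap.comp_apply, LinearEquiv.coe_coe] at this ⊢
  rw [this, e.apply_symm_apply]

lemma Module.Injective.of_linearEquiv (e : N ≃ₗ[R] Y) (hN : Module.Injective R N) :
    Module.Injective R Y := by
  refine ⟨fun X₁ X₂ _ _ _ _ f hf g => ?_⟩
  obtain ⟨ψ, hψ⟩ := hN.exists_comp_eq hf (e.symm.toLinearMap ∘ₗ g)
  exact ⟨e.toLinearMap ∘ₗ ψ, fun x => by
    simpa [LinearEquiv.eq_symm_apply] using LinearMap.congr_fun hψ x⟩

lemma lTensor_injective_of_rTensor_injective {A P : Type u} [AddCommGroup A] [Module R A]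
    [AddCommGroup P] [Module R P] [Module.Flat R P] {π : P →ₗ[R] A} (hπ : Function.Surjective π)
    {i : N →ₗ[R] Y} {q : Y →ₗ[R] Z} (hi : Function.Injective i) (hq : Function.Surjective q)
    (hiq : Function.Exact i q) (h : Function.Injective ((LinearMap.ker π).subtype.rTensor Z)) :
    Function.Injective (i.lTensor A) := by
  have hexact : Function.Exact (LinearMap.ker π).subtype π := LinearMap.exact_subtype_ker_map π
  refine (injective_iff_map_eq_zero _).2 fun t ht => ?_
  obtain ⟨s, rfl⟩ := LinearMap.rTensor_surjective N hπ t
  rw [← LinearMap.comp_apply, LinearMap.lTensor_comp_rTensor, ← LinearMap.rTensor_comp_lTensor,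
    LinearMap.comp_apply] at ht
  obtain ⟨y, hy⟩ := (rTensor_exact Y hexact hπ _).1 ht
  have hy0 : q.lTensor (LinearMap.ker π) y = 0 := by
    apply h
    rw [← LinearMap.comp_apply, LinearMap.rTensor_comp_lTensor, ← LinearMap.lTensor_comp_rTensor,
      LinearMap.comp_apply, hy, map_zero]
    exact (lTensor_exact P hiq hq _).2 ⟨s, rfl⟩
  obtain ⟨x, rfl⟩ := (lTensor_exact _ hiq hq _).1 hy0
  rw [← LinearMap.comp_apply, LinearMap.rTensor_comp_lTensor, ← LinearMap.lTensor_comp_rTensor,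
    LinearMap.comp_apply] at hy
  rw [← Module.Flat.lTensor_preserves_injective_linearMap i hi hy]
  exact (rTensor_exact N hexact hπ _).2 ⟨x, rfl⟩

lemma SyzygyTensorInjective.lTensor_injective [IsNoetherianRing R] [Module.Finite R C]
    {A : ModuleCat.{u} R} (hA : IsSyzygy C A) {i : N →ₗ[R] Y} {q : Y →ₗ[R] Z}
    (hi : Function.Injective i) (hq : Function.Surjective q) (hiq : Function.Exact i q)
    (hZ : SyzygyTensorInjective C Z) : Function.Injective (i.lTensor A) := by
  have := hA.finite inferInstance
  obtain ⟨m, π, hπ⟩ := Module.Finite.exists_fin' R A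
  exact lTensor_injective_of_rTensor_injective hπ hi hq hiq (hZ A hA m π hπ)

lemma SyzygyTensorInjective.of_exact [IsNoetherianRing R] [Module.Finite R C]
    {i : N →ₗ[R] Y} {q : Y →ₗ[R] Z}
    (hi : Function.Injective i) (hq : Function.Surjective q) (hiq : Function.Exact i q)
    (hY : SyzygyTensorInjective C Y) (hZ : SyzygyTensorInjective C Z) :
    SyzygyTensorInjective C N := by
  intro A hA m π hπ
  have h := (hY A hA m π hπ).comp (hZ.lTensor_injective (hA.ker π hπ) hi hq hiq)
  rw [← LinearMap.coe_comp] at h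
  erw [LinearMap.rTensor_comp_lTensor, ← LinearMap.lTensor_comp_rTensor, LinearMap.coe_comp] at h
  exact h.of_comp

lemma syzygyTensorInjective_hom [IsNoetherianRing R] [Module.Finite R C]
    (hC : SyzygyMapsExtend C C) (hN : Module.Injective R N) :
    SyzygyTensorInjective C (C →ₗ[R] N) := by
  intro A hA m π hπ
  refine (injective_iff_map_eq_zero _).2 fun t ht => ?_
  have := (hA.ker π hπ).finite inferInstance
  apply (tensorEval_bijective (A := LinearMap.ker π) (M := C) hN).1
  have h := tensorEval_rTensor (LinearMap.ker π).subtype t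
  rw [ht, map_zero] at h
  rw [map_zero]
  ext g
  obtain ⟨g, rfl⟩ := hC A hA m π hπ g
  exact (LinearMap.congr_fun h g).symm

lemma SyzygyMapsExtend.exists_lift {A : ModuleCat.{u} R} {q : Y →ₗ[R] Z}
    (hZ : SyzygyMapsExtend C Z) (hq : Function.Surjective q)
    (hlift : ∀ f : C →ₗ[R] Z, ∃ g : C →ₗ[R] Y, q ∘ₗ g = f) (hA : IsSyzygy C A) :
    ∀ f : A →ₗ[R] Z, ∃ g : A →ₗ[R] Y, q ∘ₗ g = f := by
  induction hA with
  | self => exact hlift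
  | @ker A hA m π hπ ih =>
    intro f
    obtain ⟨f, rfl⟩ := hZ A hA m π hπ f
    obtain ⟨g, rfl⟩ := Module.projective_lifting_property q f hq
    exact ⟨g ∘ₗ (LinearMap.ker π).subtype, rfl⟩

lemma SyzygyMapsExtend.of_exact {i : N →ₗ[R] Y} {q : Y →ₗ[R] Z}
    (hi : Function.Injective i) (hq : Function.Surjective q) (hiq : Function.Exact i q)
    (hY : SyzygyMapsExtend C Y) (hZ : SyzygyMapsExtend C Z)
    (hlift : ∀ f : C →ₗ[R] Z, ∃ g : C →ₗ[R] Y, q ∘ₗ g = f) : SyzygyMapsExtend C N := by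
  intro A hA m π hπ f
  replace hlift := hZ.exists_lift hq hlift hA
  obtain ⟨g, hg⟩ := hY A hA m π hπ (i ∘ₗ f)
  have hg (x : LinearMap.ker π) : g x = i (f x) := LinearMap.congr_fun hg x
  obtain ⟨k, hk⟩ := hlift ((LinearMap.ker π).liftQ (q ∘ₗ g) (fun x hx => by
      simp only [LinearMap.mem_ker, LinearMap.comp_apply]
      rw [hg ⟨x, hx⟩, hiq.apply_apply_eq_zero]) ∘ₗ (π.quotKerEquivOfSurjective hπ).symm)
  have hqk (x : Fin m → R) : q (k (π x)) = q (g x) := by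
    have h1 := LinearMap.congr_fun hk (π x)
    have h2 : (π.quotKerEquivOfSurjective hπ).symm (π x) = Submodule.Quotient.mk x := by
      rw [LinearEquiv.symm_apply_eq]; rfl
    simp only [LinearMap.comp_apply, LinearEquiv.coe_coe, h2] at h1
    exact h1
  have hrange (x : Fin m → R) : (g - k ∘ₗ π) x ∈ LinearMap.range i :=
    (hiq _).1 (by simp [hqk])
  let e := LinearEquiv.ofInjective i hi
  refine ⟨e.symm.toLinearMap ∘ₗ (g - k ∘ₗ π).codRestrict _ hrange, LinearMap.ext fun x => hi ?_⟩
  have : π x = 0 := x.2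
  have he (y) : i (e.symm y) = y := congrArg Subtype.val (e.apply_symm_apply y)
  simp [he, hg, this]

lemma tensorUnit_bijective_of_exact {i : N →ₗ[R] Y} {q : Y →ₗ[R] Z}
    (hi : Function.Injective i) (hiq : Function.Exact i q)
    (hCi : Function.Injective (i.lTensor C)) (hY : Function.Bijective (tensorUnit C Y))
    (hZ : Function.Injective (tensorUnit C Z)) : Function.Bijective (tensorUnit C N) := by
  constructor
  · refine (injective_iff_map_eq_zero _).2 fun x hx => hi (hY.1 ?_)
    rw [← lTensor_comp_tensorUnit, hx]
    simp
  · intro h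
    obtain ⟨y, hy⟩ := hY.2 (i.lTensor C ∘ₗ h)
    have hqy : q y = 0 := hZ (by
      rw [← lTensor_comp_tensorUnit, hy, ← LinearMap.comp_assoc, ← LinearMap.lTensor_comp,
        hiq.linearMap_comp_eq_zero]
      simp)
    obtain ⟨x, rfl⟩ := (hiq y).1 hqy
    refine ⟨x, LinearMap.ext fun c => hCi ?_⟩
    rw [← lTensor_comp_tensorUnit] at hy
    exact LinearMap.congr_fun hy c

/-- If homotheties identify `R` with `End(C)`, they identify `Hom(End(C), N)` with `N`. -/
noncomputable def homEndEquiv (hC : Function.Bijective (LinearMap.lsmul R C))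
    (N : Type u) [AddCommGroup N] [Module R N] : ((C →ₗ[R] C) →ₗ[R] N) ≃ₗ[R] N :=
  (LinearEquiv.ofBijective (LinearMap.lsmul R C) hC).symm.congrLeft N R ≪≫ₗ
    LinearMap.ringLmapEquivSelf R R N

lemma homEndEquiv_apply (hC : Function.Bijective (LinearMap.lsmul R C))
    (φ : (C →ₗ[R] C) →ₗ[R] N) : homEndEquiv hC N φ = φ LinearMap.id := by
  change φ (LinearMap.lsmul R C 1) = _
  congr 1
  ext; simp

/-- The evaluation `C ⊗ Hom(C, N) ≃ N` for an injective module `N`. -/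
noncomputable def tensorHomEquiv [IsNoetherianRing R] [Module.Finite R C]
    (hC : Function.Bijective (LinearMap.lsmul R C)) (hN : Module.Injective R N) :
    C ⊗[R] (C →ₗ[R] N) ≃ₗ[R] N :=
  LinearEquiv.ofBijective _ (tensorEval_bijective hN) ≪≫ₗ homEndEquiv hC N

lemma tensorHomEquiv_tmul [IsNoetherianRing R] [Module.Finite R C]
    (hC : Function.Bijective (LinearMap.lsmul R C)) (hN : Module.Injective R N)
    (c : C) (f : C →ₗ[R] N) : tensorHomEquiv hC hN (c ⊗ₜ f) = f c := by
  simp [tensorHomEquiv, homEndEquiv_apply]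

lemma tensorUnit_hom_bijective [IsNoetherianRing R] [Module.Finite R C]
    (hC : Function.Bijective (LinearMap.lsmul R C)) (hN : Module.Injective R N) :
    Function.Bijective (tensorUnit C (C →ₗ[R] N)) := by
  let e : (C →ₗ[R] C ⊗[R] (C →ₗ[R] N)) ≃ₗ[R] (C →ₗ[R] N) := (tensorHomEquiv hC hN).congrRight
  have he : e ∘ tensorUnit C (C →ₗ[R] N) = id := by
    ext f c
    exact tensorHomEquiv_tmul hC hN c f
  exact (Function.Bijective.of_comp_iff' e.bijective _).1 (he ▸ Function.bijective_id)

end AuslanderClass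

section AuslanderBound
variable {R : Type u} [CommRing R]

/-- `N` lies in the Auslander class of `C` and `C ⊗ N` has injective dimension less than `n`. -/
structure AuslanderBound (C : ModuleCat.{u} R) (N : Type u) [AddCommGroup N] [Module R N]
    (n : ℕ) : Prop where
  tensorInjective : SyzygyTensorInjective C N
  unit_bijective : Function.Bijective (tensorUnit C N)
  mapsExtend : SyzygyMapsExtend C (C ⊗[R] N)
  hasInjectiveDimensionLT : HasInjectiveDimensionLT (ModuleCat.of R (C ⊗[R] N)) n

variable {C : ModuleCat.{u} R} {N Y Z : Type u} [AddCommGroup N] [Module R N] [AddCommGroup Y]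
  [Module R Y] [AddCommGroup Z] [Module R Z]

lemma AuslanderBound.of_subsingleton [Subsingleton N] : AuslanderBound C N 0 where
  tensorInjective _ _ _ _ _ := Function.injective_of_subsingleton _
  unit_bijective := ⟨Function.injective_of_subsingleton _, fun _ => ⟨0, Subsingleton.elim _ _⟩⟩
  mapsExtend _ _ _ _ _ _ := ⟨0, Subsingleton.elim _ _⟩
  hasInjectiveDimensionLT := (ModuleCat.isZero_of_subsingleton _).hasInjectiveDimensionLT_zero

lemma hasInjectiveDimensionLT_of_injective (hN : Module.Injective R N) (n : ℕ) :
    HasInjectiveDimensionLT (ModuleCat.of R N) (n + 1) := by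
  have : Injective (ModuleCat.of R N) := (Module.injective_iff_injective_object R N).1 hN
  exact hasInjectiveDimensionLT_of_ge _ 1 _ (by omega)

lemma AuslanderBound.of_exact [IsNoetherianRing R] (hC : IsSemidualizing R C)
    {I : Type u} [AddCommGroup I] [Module R I] (hI : Module.Injective R I)
    {i : N →ₗ[R] C →ₗ[R] I} {q : (C →ₗ[R] I) →ₗ[R] Z} (hi : Function.Injective i)
    (hq : Function.Surjective q) (hiq : Function.Exact i q) {n : ℕ} (hZ : AuslanderBound C Z n) :
    AuslanderBound C N (n + 1) := by
  have := hC.1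
  have hCC := syzygyMapsExtend_of_extZero hC.2.2
  have hCi : Function.Injective (i.lTensor C) :=
    hZ.tensorInjective.lTensor_injective .self hi hq hiq
  have hCI : Module.Injective R (C ⊗[R] (C →ₗ[R] I)) :=
    hI.of_linearEquiv (tensorHomEquiv hC.2.1 hI).symm
  have hunit := tensorUnit_hom_bijective hC.2.1 hI
  refine ⟨.of_exact hi hq hiq (syzygyTensorInjective_hom hCC hI) hZ.tensorInjective,
    tensorUnit_bijective_of_exact hi hiq hCi hunit hZ.unit_bijective.1,
    .of_exact hCi (LinearMap.lTensor_surjective _ hq) (lTensor_exact _ hiq hq)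
      (.of_injective hCI) hZ.mapsExtend fun f => ?_, ?_⟩
  · obtain ⟨z, rfl⟩ := hZ.unit_bijective.2 f
    obtain ⟨y, rfl⟩ := hq z
    exact ⟨_, lTensor_comp_tensorUnit q y⟩
  · exact (shortExact_of_exact hCi (LinearMap.lTensor_surjective _ hq)
      (lTensor_exact _ hiq hq)).hasInjectiveDimensionLT_X₁ n hZ.hasInjectiveDimensionLT
        (hasInjectiveDimensionLT_of_injective hCI n)

lemma auslanderBound_of_coresolution [IsNoetherianRing R] (hC : IsSemidualizing R C) (n : ℕ)
    {N : Type u} [AddCommGroup N] [Module R N] (P : ℕ → ModuleCat.{u} R)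
    (d : ∀ i : ℕ, P i →ₗ[R] P (i + 1)) (η : N →ₗ[R] P 0) (hη : Function.Injective η)
    (hηd : Function.Exact η (d 0)) (hd : ∀ i : ℕ, Function.Exact (d i) (d (i + 1)))
    (hP : ∀ i < n, IsCInjective R C (P i)) (hP0 : ∀ i, n ≤ i → Subsingleton (P i)) :
    AuslanderBound C N n := by
  induction n generalizing N P with
  | zero =>
    have := hP0 0 le_rfl
    have := hη.subsingleton
    exact .of_subsingleton
  | succ n ih =>
    obtain ⟨I, hI, ⟨e⟩⟩ := hP 0 n.succ_pos
    refine .of_exact hC hI (i := e.toLinearMap ∘ₗ η) (q := (d 0).rangeRestrict ∘ₗ e.symm.toLinearMap)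
      (e.injective.comp hη) ((d 0).surjective_rangeRestrict.comp e.symm.surjective) ?_
      (ih (fun i => P (i + 1)) (fun i => d (i + 1)) (LinearMap.range (d 0)).subtype
        (Submodule.subtype_injective _) ?_ (fun i => hd (i + 1))
        (fun i hi => hP (i + 1) (by omega)) fun i hi => hP0 (i + 1) (by omega))
    · intro x
      obtain ⟨y, rfl⟩ := e.surjective x
      simpa [Subtype.ext_iff] using hηd y
    · intro x
      simpa using hd 0 x

end AuslanderBound

section CharacterModule
variable {R : Type u} [CommRing R]

lemma injective_characterModule (F : Type u) [AddCommGroup F] [Module R F] [Module.Flat R F] :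
    Module.Injective R (CharacterModule F) :=
  Module.Flat.iff_characterModule_injective.1 inferInstance

variable (R) in
/-- The Pontryagin dual of `M` as `Hom(M, R*)`. -/
noncomputable def homCharacterEquiv (M : Type u) [AddCommGroup M] [Module R M] :
    (M →ₗ[R] CharacterModule R) ≃ₗ[R] CharacterModule M :=
  CharacterModule.homEquiv ≪≫ₗ CharacterModule.congr (TensorProduct.rid R M)

lemma homCharacterEquiv_apply {M : Type u} [AddCommGroup M] [Module R M]
    (φ : M →ₗ[R] CharacterModule R) (x : M) : homCharacterEquiv R M φ x = φ x 1 := rfl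

lemma homCharacterEquiv_symm_apply {M : Type u} [AddCommGroup M] [Module R M]
    (φ : CharacterModule M) (x : M) (r : R) : (homCharacterEquiv R M).symm φ x r = φ (r • x) := by
  obtain ⟨φ, rfl⟩ := (homCharacterEquiv R M).surjective φ
  rw [LinearEquiv.symm_apply_apply, homCharacterEquiv_apply, map_smul,
    CharacterModule.smul_apply, smul_eq_mul, mul_one]

lemma CharacterModule.dual_exact {X Y Z : Type u} [AddCommGroup X] [Module R X] [AddCommGroup Y]
    [Module R Y] [AddCommGroup Z] [Module R Z] {f : X →ₗ[R] Y} {g : Y →ₗ[R] Z}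
    (h : Function.Exact f g) : Function.Exact (dual g) (dual f) := by
  intro φ
  constructor
  · intro hφ
    obtain ⟨χ, hχ⟩ := (injective_characterModule (R := R) R).exists_comp_eq_of_ker_le g
      ((homCharacterEquiv R Y).symm φ) (fun y hy => by
        obtain ⟨x, rfl⟩ := (h y).1 hy
        ext r
        rw [homCharacterEquiv_symm_apply, ← map_smul]
        exact DFunLike.congr_fun hφ (r • x))
    refine ⟨homCharacterEquiv R Z χ, DFunLike.ext _ _ fun y => ?_⟩
    have := DFunLike.congr_fun (LinearMap.congr_fun hχ y) (1 : R)
    rw [homCharacterEquiv_symm_apply, one_smul] at this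
    exact this
  · rintro ⟨χ, rfl⟩
    ext x
    exact (congrArg χ (h.apply_apply_eq_zero x)).trans (map_zero χ)

/-- The isomorphism `C ⊗ M* ≃ Hom(C, M)*`. -/
noncomputable def tensorCharacterEquiv [IsNoetherianRing R] (C M : Type u) [AddCommGroup C]
    [Module R C] [Module.Finite R C] [AddCommGroup M] [Module R M] :
    C ⊗[R] CharacterModule M ≃ₗ[R] CharacterModule (C →ₗ[R] M) :=
  (homCharacterEquiv R M).symm.lTensor C ≪≫ₗ
    LinearEquiv.ofBijective _ (tensorEval_bijective (injective_characterModule R)) ≪≫ₗ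
    homCharacterEquiv R (C →ₗ[R] M)

lemma tensorCharacterEquiv_tmul [IsNoetherianRing R] {C M : Type u} [AddCommGroup C]
    [Module R C] [Module.Finite R C] [AddCommGroup M] [Module R M] (c : C) (f : CharacterModule M)
    (g : C →ₗ[R] M) : tensorCharacterEquiv C M (c ⊗ₜ f) g = f (g c) := by
  change (homCharacterEquiv R M).symm f (g c) 1 = _
  rw [homCharacterEquiv_symm_apply, one_smul]

lemma evalMap_bijective [IsNoetherianRing R] {C M : ModuleCat.{u} R} [Module.Finite R C]
    (h : Function.Bijective (tensorUnit C (CharacterModule M))) :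
    Function.Bijective (evalMap R C M) := by
  rw [← CharacterModule.dual_bijective_iff_bijective]
  have heq : CharacterModule.homEquiv.symm ∘ CharacterModule.dual (evalMap R C M) =
      (tensorCharacterEquiv C M).congrRight (M := C) ∘ tensorUnit C (CharacterModule M) := by
    ext f c g
    exact (tensorCharacterEquiv_tmul c f g).symm
  rw [← Function.Bijective.of_comp_iff' CharacterModule.homEquiv.symm.bijective, heq]
  exact (LinearEquiv.bijective _).comp h

end CharacterModule

section Resolution
variable {R : Type u} [CommRing R] {C : ModuleCat.{u} R}

lemma HasResOfLength.of_linearEquiv {𝒳 : ModuleCat.{u} R → Prop} {n : ℕ} {M N : ModuleCat.{u} R}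
    (e : M ≃ₗ[R] N) (h : HasResOfLength R 𝒳 n M) : HasResOfLength R 𝒳 n N := by
  obtain ⟨P, d, ε, hε, hdε, hd, hP, hP0⟩ := h
  refine ⟨P, d, e.toLinearMap ∘ₗ ε, e.surjective.comp hε, fun x => ?_, hd, hP, hP0⟩
  simpa using hdε x

lemma hasResOfLength_zero {𝒳 : ModuleCat.{u} R → Prop} {M : ModuleCat.{u} R} (hM : 𝒳 M) :
    HasResOfLength R 𝒳 0 M := by
  refine ⟨fun | 0 => M | _ + 1 => ModuleCat.of R PUnit, fun _ => 0, LinearMap.id,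
    Function.surjective_id, fun x => ?_, fun i x => ?_, fun i hi => ?_, fun i hi => ?_⟩
  · simp [eq_comm]
  · exact ⟨fun _ => ⟨0, Subsingleton.elim (α := PUnit) _ _⟩, fun _ => rfl⟩
  · obtain rfl : i = 0 := by omega
    exact hM
  · obtain ⟨i, rfl⟩ := Nat.exists_eq_succ_of_ne_zero hi.ne'
    exact inferInstanceAs (Subsingleton PUnit)

lemma HasResOfLength.succ {𝒳 : ModuleCat.{u} R → Prop} {n : ℕ} {K X M : ModuleCat.{u} R}
    (hX : 𝒳 X) {i : K →ₗ[R] X} {q : X →ₗ[R] M} (hi : Function.Injective i)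
    (hq : Function.Surjective q) (hiq : Function.Exact i q) (h : HasResOfLength R 𝒳 n K) :
    HasResOfLength R 𝒳 (n + 1) M := by
  obtain ⟨P, d, ε, hε, hdε, hd, hP, hP0⟩ := h
  refine ⟨fun | 0 => X | j + 1 => P j, fun | 0 => i ∘ₗ ε | j + 1 => d j, q, hq, ?_, ?_, ?_, ?_⟩
  · intro x
    rw [hiq x]
    exact (hε.exists (p := fun y => i y = x))
  · rintro (_ | j) x
    · exact (map_eq_zero_iff i hi).trans (hdε x)
    · exact hd j x
  · rintro (_ | j) hj
    · exact hX
    · exact hP j (by omega)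
  · rintro (_ | j) hj
    · omega
    · exact hP0 j (by omega)

lemma hasResOfLength_tensor [IsNoetherianRing R] [Module.Finite R C] (n : ℕ) {N : Type u}
    [AddCommGroup N] [Module R N] (hN : SyzygyTensorInjective C N)
    (hdim : HasInjectiveDimensionLT (ModuleCat.of R (CharacterModule N)) (n + 1)) :
    HasResOfLength R (IsCFlat R C) n (ModuleCat.of R (C ⊗[R] N)) := by
  induction n generalizing N with
  | zero =>
    have hinj : Module.Injective R (CharacterModule N) :=
      (Module.injective_iff_injective_object R _).2 inferInstance
    exact hasResOfLength_zero ⟨ModuleCat.of R N, Module.Flat.iff_characterModule_injective.2 hinj,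
      ⟨TensorProduct.comm R C N⟩⟩
  | succ n ih =>
    obtain ⟨F, hF, p, hp⟩ : ∃ (F : ModuleCat.{u} R) (_ : Module.Flat R F) (p : F →ₗ[R] N),
        Function.Surjective p :=
      ⟨ModuleCat.of R (N →₀ R), inferInstanceAs (Module.Flat R (N →₀ R)),
        Finsupp.linearCombination R id, Finsupp.linearCombination_id_surjective R N⟩
    have hi := Submodule.subtype_injective (LinearMap.ker p)
    have hexact := LinearMap.exact_subtype_ker_map p
    have hdimK := (shortExact_of_exact (CharacterModule.dual_injective_of_surjective p hp)
      (CharacterModule.dual_surjective_of_injective _ hi)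
      (CharacterModule.dual_exact hexact)).hasInjectiveDimensionLT_X₃ (n + 1)
      (hasInjectiveDimensionLT_of_injective (injective_characterModule F) n) hdim
    exact .succ (X := ModuleCat.of R (C ⊗[R] F)) ⟨F, hF, ⟨TensorProduct.comm R C F⟩⟩
      (hN.lTensor_injective .self hi hp hexact) (LinearMap.lTensor_surjective _ hp)
      (lTensor_exact _ hexact hp) (ih (.of_exact hi hp hexact .of_flat hN) hdimK)

lemma IsCFlat.isCInjective_characterModule {M : ModuleCat.{u} R} (hM : IsCFlat R C M) :
    IsCInjective R C (ModuleCat.of R (CharacterModule M)) := by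
  obtain ⟨F, hF, ⟨e⟩⟩ := hM
  exact ⟨ModuleCat.of R (CharacterModule F), injective_characterModule F,
    ⟨CharacterModule.congr (e ≪≫ₗ TensorProduct.comm R F C) ≪≫ₗ CharacterModule.homEquiv.symm⟩⟩

lemma HasResOfLength.characterModule {M : ModuleCat.{u} R} {n : ℕ}
    (h : HasResOfLength R (IsCFlat R C) n M) :
    HasCoresOfLength R (IsCInjective R C) n (ModuleCat.of R (CharacterModule M)) := by
  obtain ⟨P, d, ε, hε, hdε, hd, hP, hP0⟩ := h
  refine ⟨fun i => ModuleCat.of R (CharacterModule (P i)), fun i => CharacterModule.dual (d i),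
    CharacterModule.dual ε, CharacterModule.dual_injective_of_surjective ε hε,
    CharacterModule.dual_exact hdε, fun i => CharacterModule.dual_exact (hd i),
    fun i hi => (hP i hi).isCInjective_characterModule, fun i hi => ?_⟩
  have := hP0 i hi
  refine ⟨fun f g => DFunLike.ext (F := CharacterModule (P i)) _ _ fun x => ?_⟩
  rw [Subsingleton.elim x 0, map_zero, map_zero]

end Resolution

/-- `M` admits a `C`-flat resolution of length at most `n` iff the
Pontryagin dual `M*` admits a `C`-injective coresolution of length at most `n`. -/
theorem stmt12 (R : Type u) [CommRing R] [IsNoetherianRing R]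
    (C : ModuleCat.{u} R) (hC : IsSemidualizing R C) (M : ModuleCat.{u} R) (n : ℕ) :
    HasResOfLength R (IsCFlat R C) n M ↔
      HasCoresOfLength R (IsCInjective R C) n (ModuleCat.of R (CharacterModule ↥M)) := by
  refine ⟨HasResOfLength.characterModule, fun ⟨P, d, η, hη, hηd, hd, hP, hP0⟩ => ?_⟩
  have := hC.1
  have hM : AuslanderBound C (CharacterModule M) (n + 1) :=
    auslanderBound_of_coresolution hC (n + 1) P d η hη hηd hd
      (fun i hi => hP i (by omega)) fun i hi => hP0 i (by omega)
  let e := tensorCharacterEquiv (R := R) C M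
  have := hM.hasInjectiveDimensionLT
  exact (hasResOfLength_tensor n (syzygyTensorInjective_iff.2 (hM.mapsExtend.of_linearEquiv e))
    (hasInjectiveDimensionLT_of_iso e.toModuleIso (n + 1))).of_linearEquiv
      (LinearEquiv.ofBijective _ (evalMap_bijective hM.unit_bijective))
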